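/- arXiv:0707.0532 — 2 statements merged into one kernel-verified Lean document; each statement's English description precedes it below -/
import Mathlib

section
/- For every positive integer r, the identity ∑_{λ ∈ Y(r)} F_λ(q,t) s^{|λ|} = ∏_{i=1}^{r} (t s^i; q)_∞ / (s^i; q)_∞ holds, where for λ = (λ_1, …, λ_r) ∈ Y(r) with d_i = λ_i - λ_{i+1} one has F_λ(q,t) = ∏_{i=1}^{r} ∏_{j=1}^{d_i} (1 - t q^{j-1}) / (1 - q^j), as an identity of formal power series in s with coefficients rational functions of q and t (equivalently, for real 0 ≤ q, t, s < 1). -/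
open scoped BigOperators

/-- An ordinary partition `λ = (λ₁ ≥ λ₂ ≥ …)` with finitely many nonzero
parts; `part i` is the part `λ_{i+1}` (indexing from `0`). -/
structure NatPartition where
  part : ℕ → ℕ
  decr : ∀ i, part (i + 1) ≤ part i
  finite_supp : {i : ℕ | part i ≠ 0}.Finite

namespace NatPartition

/-- The weight `|λ|`: the sum of the parts. -/
noncomputable def weight (l : NatPartition) : ℕ := ∑ᶠ i : ℕ, l.part i

/-- `k(λ)`: the number of distinct nonzero parts of `λ`. -/
noncomputable def distinctParts (l : NatPartition) : ℕ :=
  {n : ℕ | n ≠ 0 ∧ ∃ i, l.part i = n}.ncard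

end NatPartition

/-- The infinite `q`-Pochhammer symbol `(x; q)_∞ = ∏_{n ≥ 0} (1 - x qⁿ)`. -/
noncomputable def qPoch (x q : ℝ) : ℝ := ∏' n : ℕ, (1 - x * q ^ n)

open Filter Topology

/-- Finite products of sums of nonnegative series over `ι`, expanded as a sum over tuples. -/
theorem hasSum_prod_fin_of_nonneg {ι : Type*} {n : ℕ} (f : Fin n → ι → ℝ) (S : Fin n → ℝ)
    (hf : ∀ i, HasSum (f i) (S i)) (h0 : ∀ i a, 0 ≤ f i a) :
    HasSum (fun d : Fin n → ι => ∏ i, f i (d i)) (∏ i, S i) := by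
  induction n with
  | zero => simp
  | succ n ih =>
    have h := ih (fun i => f i.succ) (fun i => S i.succ) (fun i => hf _) (fun i => h0 _)
    have hs := (hf 0).summable.mul_of_nonneg h.summable (h0 0)
      (fun d => Finset.prod_nonneg fun i _ => h0 _ _)
    have hm := (hf 0).mul h hs
    rw [← (Fin.consEquiv fun _ : Fin (n + 1) => ι).hasSum_iff, Fin.prod_univ_succ]
    refine hm.congr_fun ?_
    intro p
    simp [Fin.consEquiv, Fin.prod_univ_succ]

/-- The coefficient `(t; q)_d / (q; q)_d`. -/
noncomputable def qBinomCoeff (q t : ℝ) (d : ℕ) : ℝ :=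
  ∏ j ∈ Finset.range d, (1 - t * q ^ j) / (1 - q ^ (j + 1))

section qBinomial

variable {q t z : ℝ}

theorem one_sub_pow_succ_pos (hq0 : 0 ≤ q) (hq1 : q < 1) (d : ℕ) : 0 < 1 - q ^ (d + 1) :=
  sub_pos.2 (pow_lt_one₀ hq0 hq1 d.succ_ne_zero)

theorem one_sub_mul_pow_nonneg (hq0 : 0 ≤ q) (hq1 : q < 1) (ht1 : t < 1)
    (d : ℕ) : 0 ≤ 1 - t * q ^ d :=
  sub_nonneg.2 (mul_le_one₀ ht1.le (pow_nonneg hq0 d) (pow_le_one₀ hq0 hq1.le))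

theorem qBinomCoeff_nonneg (hq0 : 0 ≤ q) (hq1 : q < 1) (ht1 : t < 1) (d : ℕ) :
    0 ≤ qBinomCoeff q t d :=
  Finset.prod_nonneg fun j _ =>
    div_nonneg (one_sub_mul_pow_nonneg hq0 hq1 ht1 j) (one_sub_pow_succ_pos hq0 hq1 j).le

theorem qBinomCoeff_succ (q t : ℝ) (d : ℕ) :
    qBinomCoeff q t (d + 1) = qBinomCoeff q t d * ((1 - t * q ^ d) / (1 - q ^ (d + 1))) :=
  Finset.prod_range_succ _ _

theorem summable_qBinomCoeff_mul_pow (hq0 : 0 ≤ q) (hq1 : q < 1) (ht1 : t < 1)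
    (hz0 : 0 ≤ z) (hz1 : z < 1) : Summable fun d => qBinomCoeff q t d * z ^ d := by
  obtain ⟨c, hzc, hc1⟩ := exists_between hz1
  have hq : Tendsto (fun d : ℕ => (1 - t * q ^ d) / (1 - q ^ (d + 1)) * z) atTop (𝓝 z) := by
    have h := tendsto_pow_atTop_nhds_zero_of_lt_one hq0 hq1
    have h' := h.comp (tendsto_add_atTop_nat 1)
    have := (((h.const_mul t).const_sub 1).div (h'.const_sub 1) (by simp)).mul_const z
    simpa using this
  refine summable_of_ratio_norm_eventually_le hc1 ?_
  filter_upwards [hq.eventually_lt_const hzc] with d hd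
  have hn : ∀ d, 0 ≤ qBinomCoeff q t d * z ^ d := fun d =>
    mul_nonneg (qBinomCoeff_nonneg hq0 hq1 ht1 d) (pow_nonneg hz0 d)
  rw [Real.norm_of_nonneg (hn _), Real.norm_of_nonneg (hn _), qBinomCoeff_succ, pow_succ]
  calc _ = (1 - t * q ^ d) / (1 - q ^ (d + 1)) * z * (qBinomCoeff q t d * z ^ d) := by ring
    _ ≤ _ := mul_le_mul_of_nonneg_right hd.le (hn d)

theorem tsum_qBinomCoeff_mul_pow_step (hq0 : 0 ≤ q) (hq1 : q < 1) (ht1 : t < 1)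
    (hz0 : 0 ≤ z) (hz1 : z < 1) :
    (1 - z) * ∑' d, qBinomCoeff q t d * z ^ d =
      (1 - t * z) * ∑' d, qBinomCoeff q t d * (z * q) ^ d := by
  have h1 := summable_qBinomCoeff_mul_pow hq0 hq1 ht1 hz0 hz1
  have h2 := summable_qBinomCoeff_mul_pow hq0 hq1 ht1 (mul_nonneg hz0 hq0)
    (mul_lt_one_of_nonneg_of_lt_one_left hz0 hz1 hq1.le)
  have key : ∑' d, qBinomCoeff q t d * z ^ d - ∑' d, qBinomCoeff q t d * (z * q) ^ d =
      z * (∑' d, qBinomCoeff q t d * z ^ d - t * ∑' d, qBinomCoeff q t d * (z * q) ^ d) := by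
    rw [← h1.tsum_sub h2, (h1.sub h2).tsum_eq_zero_add, ← tsum_mul_left (a := t),
      ← h1.tsum_sub (h2.mul_left t), ← tsum_mul_left]
    simp only [pow_zero, sub_self, zero_add]
    refine tsum_congr fun d => ?_
    have := (one_sub_pow_succ_pos hq0 hq1 d).ne'
    rw [qBinomCoeff_succ]
    field_simp
    ring
  linear_combination key

theorem prod_mul_tsum_qBinomCoeff (hq0 : 0 ≤ q) (hq1 : q < 1) (ht1 : t < 1)
    (hz0 : 0 ≤ z) (hz1 : z < 1) (N : ℕ) :
    (∏ n ∈ Finset.range N, (1 - z * q ^ n)) * ∑' d, qBinomCoeff q t d * z ^ d =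
      (∏ n ∈ Finset.range N, (1 - t * z * q ^ n)) *
        ∑' d, qBinomCoeff q t d * (z * q ^ N) ^ d := by
  induction N with
  | zero => simp
  | succ N ih =>
    have h := tsum_qBinomCoeff_mul_pow_step hq0 hq1 ht1 (mul_nonneg hz0 (pow_nonneg hq0 N))
      (mul_lt_one_of_nonneg_of_lt_one_left hz0 hz1 (pow_le_one₀ hq0 hq1.le))
    rw [Finset.prod_range_succ, Finset.prod_range_succ, pow_succ, ← mul_assoc z]
    linear_combination (1 - z * q ^ N) * ih + (∏ n ∈ Finset.range N, (1 - t * z * q ^ n)) * h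

theorem tendsto_prod_range_qPoch (hq0 : 0 ≤ q) (hq1 : q < 1) (x : ℝ) :
    Tendsto (fun N => ∏ n ∈ Finset.range N, (1 - x * q ^ n)) atTop (𝓝 (qPoch x q)) := by
  have h : Summable fun n : ℕ => -(x * q ^ n) :=
    ((summable_geometric_of_lt_one hq0 hq1).mul_left x).neg
  simpa [qPoch, sub_eq_add_neg] using
    (Real.multipliable_one_add_of_summable h).tendsto_prod_tprod_nat

theorem tendsto_tsum_qBinomCoeff (hq0 : 0 ≤ q) (hq1 : q < 1) (ht1 : t < 1)
    (hz0 : 0 ≤ z) (hz1 : z < 1) :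
    Tendsto (fun N : ℕ => ∑' d, qBinomCoeff q t d * (z * q ^ N) ^ d) atTop (𝓝 1) := by
  have h1 : ∑' d, qBinomCoeff q t d * (0 : ℝ) ^ d = 1 := by
    rw [tsum_eq_single 0 fun d hd => by simp [hd]]
    simp [qBinomCoeff]
  rw [← h1]
  refine tendsto_tsum_of_dominated_convergence
    (summable_qBinomCoeff_mul_pow hq0 hq1 ht1 hz0 hz1) (fun d => ?_) (.of_forall fun N d => ?_)
  · have := (tendsto_pow_atTop_nhds_zero_of_lt_one hq0 hq1).const_mul z
    rw [mul_zero] at this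
    exact (this.pow d).const_mul _
  · have hzq := mul_nonneg hz0 (pow_nonneg hq0 N)
    have ha := qBinomCoeff_nonneg hq0 hq1 ht1 d
    rw [Real.norm_of_nonneg (mul_nonneg ha (pow_nonneg hzq d))]
    gcongr
    exact mul_le_of_le_one_right hz0 (pow_le_one₀ hq0 hq1.le)

theorem qPoch_mul_tsum_qBinomCoeff (hq0 : 0 ≤ q) (hq1 : q < 1) (ht1 : t < 1)
    (hz0 : 0 ≤ z) (hz1 : z < 1) :
    qPoch z q * ∑' d, qBinomCoeff q t d * z ^ d = qPoch (t * z) q := by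
  have hl := (tendsto_prod_range_qPoch hq0 hq1 z).mul_const (∑' d, qBinomCoeff q t d * z ^ d)
  have hr := (tendsto_prod_range_qPoch hq0 hq1 (t * z)).mul
    (tendsto_tsum_qBinomCoeff hq0 hq1 ht1 hz0 hz1)
  rw [mul_one] at hr
  refine tendsto_nhds_unique hl (hr.congr fun N => ?_)
  exact (prod_mul_tsum_qBinomCoeff hq0 hq1 ht1 hz0 hz1 N).symm

theorem qPoch_ne_zero (hq0 : 0 ≤ q) (hq1 : q < 1) (hz0 : 0 ≤ z) (hz1 : z < 1) :
    qPoch z q ≠ 0 := by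
  have h := qPoch_mul_tsum_qBinomCoeff hq0 hq1 zero_lt_one hz0 hz1
  refine left_ne_zero_of_mul (h.trans_ne ?_)
  simp [qPoch]

/-- The `q`-binomial theorem. -/
theorem hasSum_qBinomCoeff_mul_pow (hq0 : 0 ≤ q) (hq1 : q < 1) (ht1 : t < 1)
    (hz0 : 0 ≤ z) (hz1 : z < 1) :
    HasSum (fun d => qBinomCoeff q t d * z ^ d) (qPoch (t * z) q / qPoch z q) := by
  rw [← qPoch_mul_tsum_qBinomCoeff hq0 hq1 ht1 hz0 hz1,
    mul_div_cancel_left₀ _ (qPoch_ne_zero hq0 hq1 hz0 hz1)]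
  exact (summable_qBinomCoeff_mul_pow hq0 hq1 ht1 hz0 hz1).hasSum

end qBinomial

namespace NatPartition

theorem ext_of_part {l m : NatPartition} (h : ∀ i, l.part i = m.part i) : l = m := by
  cases l
  cases m
  congr
  exact funext h

/-- The partition with consecutive differences `d 0, …, d (r - 1)`. -/
def ofDiffs {r : ℕ} (d : Fin r → ℕ) : NatPartition where
  part i := ∑ j : Fin r, if i ≤ j then d j else 0
  decr i := Finset.sum_le_sum fun j _ => by split_ifs <;> omega
  finite_supp := (Set.finite_lt_nat r).subset fun i hi => by
    by_contra h
    refine hi (Finset.sum_eq_zero fun j _ => if_neg ?_)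
    have := j.isLt
    simp only [Set.mem_ofPred_eq] at h
    omega

theorem part_ofDiffs_eq_zero {r : ℕ} (d : Fin r → ℕ) {i : ℕ} (hi : r ≤ i) :
    (ofDiffs d).part i = 0 := by
  simp only [ofDiffs]
  exact Finset.sum_eq_zero fun j _ => if_neg (by omega)

theorem part_ofDiffs_eq_add {r : ℕ} (d : Fin r → ℕ) (i : Fin r) :
    (ofDiffs d).part i = (ofDiffs d).part (i + 1) + d i := by
  have h : d i = ∑ j : Fin r, if j = i then d j else 0 := by simp
  rw [h]
  simp only [ofDiffs, ← Finset.sum_add_distrib]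
  refine Finset.sum_congr rfl fun j _ => ?_
  simp only [Fin.ext_iff]
  split_ifs <;> omega

theorem weight_ofDiffs {r : ℕ} (d : Fin r → ℕ) :
    (ofDiffs d).weight = ∑ j : Fin r, (j + 1) * d j := by
  rw [weight, finsum_eq_sum_of_support_subset (s := Finset.range r)]
  · simp only [ofDiffs]
    rw [Finset.sum_comm]
    refine Finset.sum_congr rfl fun j _ => ?_
    rw [← Finset.sum_filter, Finset.sum_const, smul_eq_mul]
    congr 1
    rw [← Finset.card_range (j + 1)]
    congr 1
    ext i
    have := j.isLt
    simp only [Finset.mem_filter, Finset.mem_range]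
    omega
  · intro i hi
    simp only [Finset.coe_range, Set.mem_Iio]
    by_contra h
    exact hi (part_ofDiffs_eq_zero d (not_lt.1 h))

/-- Partitions with at most `r` parts correspond to their `r` consecutive differences. -/
def diffsEquiv (r : ℕ) : (Fin r → ℕ) ≃ {l : NatPartition // ∀ i, r ≤ i → l.part i = 0} where
  toFun d := ⟨ofDiffs d, fun _ => part_ofDiffs_eq_zero d⟩
  invFun l i := l.1.part i - l.1.part (i + 1)
  left_inv d := funext fun i => by simp [part_ofDiffs_eq_add d i]
  right_inv l := by
    refine Subtype.ext (ext_of_part fun i => ?_)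
    obtain h | h := le_total r i
    · rw [l.2 i h, part_ofDiffs_eq_zero _ h]
    · induction h using Nat.decreasingInduction with
      | self => rw [l.2 r le_rfl, part_ofDiffs_eq_zero _ le_rfl]
      | of_succ k hk ih =>
        have h := part_ofDiffs_eq_add (fun i : Fin r => l.1.part i - l.1.part (i + 1)) ⟨k, hk⟩
        have := l.1.decr k
        simp only at h ih ⊢
        omega

end NatPartition

/-- For every positive integer `r`,
`∑_{λ ∈ Y(r)} F_λ(q,t) s^{|λ|} = ∏_{i=1}^{r} (t sⁱ; q)_∞ / (sⁱ; q)_∞`,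
where `Y(r)` is the set of partitions with at most `r` nonzero parts and,
with `d_i = λ_i - λ_{i+1}`,
`F_λ(q,t) = ∏_{i=1}^{r} ∏_{j=1}^{d_i} (1 - t q^{j-1}) / (1 - q^j)`,
for real `0 ≤ q, t, s < 1`. -/
theorem generating_function_partitions_boxed
    (q t s : ℝ) (hq0 : 0 ≤ q) (hq1 : q < 1) (ht0 : 0 ≤ t) (ht1 : t < 1)
    (hs0 : 0 ≤ s) (hs1 : s < 1) (r : ℕ) (hr : 0 < r) :
    ∑' l : {l : NatPartition // ∀ i, r ≤ i → l.part i = 0},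
        (∏ i ∈ Finset.range r, ∏ j ∈ Finset.range (l.1.part i - l.1.part (i + 1)),
            (1 - t * q ^ j) / (1 - q ^ (j + 1))) * s ^ l.1.weight =
      ∏ i ∈ Finset.range r, qPoch (t * s ^ (i + 1)) q / qPoch (s ^ (i + 1)) q := by
  have hz : ∀ i : ℕ, s ^ (i + 1) < 1 := fun i => pow_lt_one₀ hs0 hs1 i.succ_ne_zero
  have h := hasSum_prod_fin_of_nonneg (n := r)
    (fun i d => qBinomCoeff q t d * (s ^ ((i : ℕ) + 1)) ^ d) _
    (fun i => hasSum_qBinomCoeff_mul_pow hq0 hq1 ht1 (pow_nonneg hs0 _) (hz i))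
    (fun i d => mul_nonneg (qBinomCoeff_nonneg hq0 hq1 ht1 d)
      (pow_nonneg (pow_nonneg hs0 _) d))
  rw [← (NatPartition.diffsEquiv r).tsum_eq, Finset.prod_range, ← h.tsum_eq]
  refine tsum_congr fun d => ?_
  simp only [NatPartition.diffsEquiv, Equiv.coe_fn_mk, NatPartition.weight_ofDiffs]
  rw [Finset.prod_range, Finset.prod_mul_distrib, ← Finset.prod_pow_eq_pow_sum]
  congr 1
  · refine Finset.prod_congr rfl fun i _ => ?_
    rw [NatPartition.part_ofDiffs_eq_add d i, Nat.add_sub_cancel_left, qBinomCoeff]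
  · simp only [pow_mul]
end

section
/- Generalized shifted MacMahon's formula (boxed version): For every pair of positive integers r, c, ∑_{π ∈ SP(r,c)} 2^{k(π)} x^{tr(π)} s^{|π|} = ∏_{i=1}^{r} ∏_{j=1}^{c} (1 + x s^{i+j-1}) / (1 - x s^{i+j-1}), as an identity of formal power series in s and x (equivalently, for real 0 ≤ x, s < 1 with xs < 1). -/
open scoped BigOperators

/-- A plane partition: a filling of a Young diagram (its support) with positive
integers that are weakly decreasing along rows and columns.  Entries outside
the support are recorded as `0`, and rows and columns are indexed from `0`
(so box `(i, j)` is box `(i+1, j+1)` in the 1-indexed convention). -/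
structure PlanePartition where
  part : ℕ → ℕ → ℕ
  row_decr : ∀ i j, part i (j + 1) ≤ part i j
  col_decr : ∀ i j, part (i + 1) j ≤ part i j
  finite_supp : {p : ℕ × ℕ | part p.1 p.2 ≠ 0}.Finite

namespace PlanePartition

/-- The weight `|π|`: the sum of all entries of `π`. -/
noncomputable def weight (π : PlanePartition) : ℕ := ∑ᶠ p : ℕ × ℕ, π.part p.1 p.2

/-- The trace `tr(π)`: the sum of the diagonal entries of `π`. -/
noncomputable def trace (π : PlanePartition) : ℕ := ∑ᶠ i : ℕ, π.part i i

/-- A strict plane partition: all of the diagonal partitions of `π` have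
distinct parts, i.e. every diagonal of `π` is strictly decreasing where
nonzero. -/
def IsStrict (π : PlanePartition) : Prop :=
  ∀ i j, π.part i j ≠ 0 → π.part (i + 1) (j + 1) < π.part i j

end PlanePartition

/-- Two boxes of `ℕ × ℕ` are adjacent when they share an edge. -/
def Adjacent (p q : ℕ × ℕ) : Prop :=
  (p.1 = q.1 ∧ (p.2 + 1 = q.2 ∨ q.2 + 1 = p.2)) ∨
  (p.2 = q.2 ∧ (p.1 + 1 = q.1 ∨ q.1 + 1 = p.1))

/-- One step of connectivity for a filling `g` of boxes by natural numbers: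
adjacent boxes carrying the same nonzero entry. -/
def ConnStep (g : ℕ → ℕ → ℕ) (p q : ℕ × ℕ) : Prop :=
  Adjacent p q ∧ g p.1 p.2 = g q.1 q.2 ∧ g p.1 p.2 ≠ 0

/-- `p` and `q` belong to the same connected component of `g`: both are boxes
of the support and they are joined by a chain of adjacent boxes all filled
with the same number. -/
def SameComponent (g : ℕ → ℕ → ℕ) (p q : ℕ × ℕ) : Prop :=
  g p.1 p.2 ≠ 0 ∧ Relation.ReflTransGen (ConnStep g) p q

/-- The set of connected components of a filling `g`. -/
def components (g : ℕ → ℕ → ℕ) : Set (Set (ℕ × ℕ)) :=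
  {C | ∃ p : ℕ × ℕ, g p.1 p.2 ≠ 0 ∧ C = {q | SameComponent g p q}}

/-- `k(g)`: the number of connected components. -/
noncomputable def numComponents (g : ℕ → ℕ → ℕ) : ℕ := (components g).ncard

/-- The level `h(p)` of a box `p`: the smallest positive `h` such that the box
shifted diagonally by `h` does not belong to the same connected component. -/
noncomputable def level (g : ℕ → ℕ → ℕ) (p : ℕ × ℕ) : ℕ :=
  sInf {h : ℕ | 0 < h ∧ ¬ SameComponent g p (p.1 + h, p.2 + h)}

/-- One step of border connectivity: adjacent boxes with the same nonzero
entry and the same level. -/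
def BorderStep (g : ℕ → ℕ → ℕ) (p q : ℕ × ℕ) : Prop :=
  ConnStep g p q ∧ level g p = level g q

/-- `p` and `q` belong to the same border component. -/
def SameBorder (g : ℕ → ℕ → ℕ) (p q : ℕ × ℕ) : Prop :=
  g p.1 p.2 ≠ 0 ∧ Relation.ReflTransGen (BorderStep g) p q

/-- The set of border components of a filling `g` (each border component is a
maximal connected set of boxes with the same entry and the same level). -/
def borderComponents (g : ℕ → ℕ → ℕ) : Set (Set (ℕ × ℕ)) :=
  {B | ∃ p : ℕ × ℕ, g p.1 p.2 ≠ 0 ∧ B = {q | SameBorder g p q}}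

/-- The (common) level of the boxes of a border component `B`. -/
noncomputable def borderLevel (g : ℕ → ℕ → ℕ) (B : Set (ℕ × ℕ)) : ℕ :=
  sInf {h : ℕ | ∃ p ∈ B, level g p = h}

/-- The polynomial `A_π(t)`: the product over all border components `B` of
`π` of `(1 - t ^ level(B))`; equivalently the product over connected
components `C` of `P_C(t) = ∏_i (1 - t^i)^{n_i}` where `n_i` is the number of
`i`-level border components of `C`. -/
noncomputable def Apoly (t : ℝ) (π : PlanePartition) : ℝ :=
  ∏ᶠ B ∈ borderComponents π.part, (1 - t ^ borderLevel π.part B)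

/-- The function `f(n, m)` (for parameters `q`, `t`); the empty product gives
`f(0, m) = 1`. -/
noncomputable def fmac (q t : ℝ) (n m : ℕ) : ℝ :=
  ∏ i ∈ Finset.range n, (1 - q ^ i * t ^ (m + 1)) / (1 - q ^ (i + 1) * t ^ m)

/-- `F_π(i,j)(q,t)`, associated to the box `(i, j)` of `π`: with
`λ = (π(i,j), π(i+1,j+1), …)`, `μ = (π(i+1,j), π(i+2,j+1), …)` and
`ν = (π(i,j+1), π(i+1,j+2), …)`, this is
`∏_{m ≥ 0} f(λ₁-μ_{m+1},m) f(λ₁-ν_{m+1},m) / (f(λ₁-λ_{m+1},m) f(λ₁-λ_{m+2},m))`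
(only finitely many factors differ from `1`). -/
noncomputable def Fbox (q t : ℝ) (π : PlanePartition) (i j : ℕ) : ℝ :=
  ∏' m : ℕ,
    (fmac q t (π.part i j - π.part (i + 1 + m) (j + m)) m *
        fmac q t (π.part i j - π.part (i + m) (j + 1 + m)) m) /
      (fmac q t (π.part i j - π.part (i + m) (j + m)) m *
        fmac q t (π.part i j - π.part (i + m + 1) (j + m + 1)) m)

/-- `F_π(q,t)`: the product of `F_π(i,j)(q,t)` over all boxes `(i,j)` of the
support of `π`. -/
noncomputable def Fmac (q t : ℝ) (π : PlanePartition) : ℝ :=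
  ∏ᶠ p : ℕ × ℕ, if π.part p.1 p.2 ≠ 0 then Fbox q t π p.1 p.2 else 1

section

open Finset

/-- The number of elements of `S` that are at least `n`. -/
def tailCard (S : Finset ℕ) (n : ℕ) : ℕ := #{m ∈ S | n ≤ m}

/-- The size of the strict partition with parts `m + 1`, for `m ∈ S`. -/
def partSize (S : Finset ℕ) : ℕ := ∑ m ∈ S, (m + 1)

/-- The strict partition encoded by `T` is obtained from that of `S` by adding a
horizontal strip. -/
def Interlace (S T : Finset ℕ) : Prop :=
  ∀ n, tailCard S n ≤ tailCard T n ∧ tailCard T n ≤ tailCard S n + 1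

open Classical in
/-- The weight of a step adding a horizontal strip. -/
noncomputable def upWeight (z : ℝ) (S T : Finset ℕ) : ℝ :=
  if Interlace S T then 2 ^ #(T \ S) * z ^ (partSize T - partSize S) else 0

open Classical in
/-- The weight of a step removing a horizontal strip. -/
noncomputable def downWeight (z : ℝ) (S T : Finset ℕ) : ℝ :=
  if Interlace T S then 2 ^ #(T \ S) * z ^ (partSize S - partSize T) else 0

/-- The indicator of `n ∈ S`. -/
def occ (S : Finset ℕ) (n : ℕ) : ℤ := if n ∈ S then 1 else 0

/-- The Boltzmann weight of a horizontal edge in state `h`. -/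
noncomputable def stateWeight (z : ℝ) (h : ℤ) : ℝ := if h = 0 then 1 else if h = 1 then z else 0

/-- The partition function of a row of the vertex model with columns `n - 1, …, 0`, where
`S` lies below `T`, the incoming state is `h`, and each new element of `B` relative to `A`
has weight two. -/
noncomputable def rowWeight (z : ℝ) (S T A B : Finset ℕ) : ℕ → ℤ → ℝ
  | 0, _ => 1
  | n + 1, h => stateWeight z (h + occ T n - occ S n) * (if n ∈ B ∧ n ∉ A then 2 else 1) *
      rowWeight z S T A B n (h + occ T n - occ S n)

lemma tailCard_eq_zero {S : Finset ℕ} {N n : ℕ} (hS : S ⊆ range N) (hn : N ≤ n) :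
    tailCard S n = 0 := by
  rw [tailCard, card_eq_zero, filter_eq_empty_iff]
  intro m hm
  have := mem_range.1 (hS hm)
  omega

lemma tailCard_eq_succ (S : Finset ℕ) (n : ℕ) :
    (tailCard S n : ℤ) = tailCard S (n + 1) + occ S n := by
  have h : ({m ∈ S | n ≤ m} : Finset ℕ) = {m ∈ S | n + 1 ≤ m} ∪ {m ∈ S | m = n} := by
    ext m; simp only [mem_filter, mem_union]; grind
  rw [tailCard, tailCard, h, card_union_of_disjoint, occ, filter_eq']
  · split_ifs <;> simp
  · rw [disjoint_filter]; intros; omega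

lemma sum_tailCard {S : Finset ℕ} {N : ℕ} (hS : S ⊆ range N) :
    ∑ n ∈ range N, tailCard S n = partSize S := by
  simp only [tailCard, card_filter, partSize]
  rw [sum_comm]
  refine sum_congr rfl fun m hm ↦ ?_
  have := mem_range.1 (hS hm)
  rw [← card_filter]
  have h : ({n ∈ range N | n ≤ m} : Finset ℕ) = range (m + 1) := by
    ext n; simp only [mem_filter, mem_range]; omega
  rw [h, card_range]

lemma rowWeight_eq_prod (z : ℝ) (S T A B : Finset ℕ) (N : ℕ) :
    rowWeight z S T A B N (tailCard T N - tailCard S N) =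
      ∏ n ∈ range N, (stateWeight z (tailCard T n - tailCard S n) *
        if n ∈ B ∧ n ∉ A then 2 else 1) := by
  induction N with
  | zero => simp [rowWeight]
  | succ N ih =>
    have h : (tailCard T (N + 1) : ℤ) - tailCard S (N + 1) + occ T N - occ S N =
        tailCard T N - tailCard S N := by
      rw [tailCard_eq_succ T N, tailCard_eq_succ S N]; ring
    rw [rowWeight, h, ih, prod_range_succ, mul_comm]

lemma Interlace.stateWeight {S T : Finset ℕ} (h : Interlace S T) (z : ℝ) (n : ℕ) :
    stateWeight z (tailCard T n - tailCard S n) = z ^ (tailCard T n - tailCard S n) := by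
  obtain ⟨h1, h2⟩ := h n
  obtain h | h : tailCard T n = tailCard S n ∨ tailCard T n = tailCard S n + 1 := by omega
  · simp [_root_.stateWeight, h]
  · simp [_root_.stateWeight, h]

open Classical in
lemma rowWeight_zero (z : ℝ) {S T A B : Finset ℕ} {N : ℕ} (hS : S ⊆ range N) (hT : T ⊆ range N)
    (hB : B ⊆ range N) : rowWeight z S T A B N 0 =
      if Interlace S T then 2 ^ #(B \ A) * z ^ (partSize T - partSize S) else 0 := by
  have h0 := rowWeight_eq_prod z S T A B N
  rw [tailCard_eq_zero hS le_rfl, tailCard_eq_zero hT le_rfl] at h0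
  simp only [Nat.cast_zero, sub_zero] at h0
  rw [h0, prod_mul_distrib, prod_ite, prod_const, prod_const_one, mul_one]
  have hBA : ({n ∈ range N | n ∈ B ∧ n ∉ A} : Finset ℕ) = B \ A := by
    ext n; simp only [mem_filter, Finset.mem_sdiff]
    exact ⟨fun h ↦ h.2, fun h ↦ ⟨hB h.1, h⟩⟩
  rw [hBA, mul_comm]
  split_ifs with h
  · simp_rw [h.stateWeight, prod_pow_eq_pow_sum]
    rw [← sum_tailCard hS, ← sum_tailCard hT, sum_tsub_distrib _ fun n _ ↦ (h n).1]
  · have : ∃ n, ¬ (tailCard S n ≤ tailCard T n ∧ tailCard T n ≤ tailCard S n + 1) := by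
      simpa [Interlace] using h
    obtain ⟨n, hn⟩ := this
    have hnN : n < N := by
      by_contra! hc
      rw [tailCard_eq_zero hS hc, tailCard_eq_zero hT hc] at hn
      omega
    rw [prod_eq_zero (mem_range.2 hnN), mul_zero]
    rw [stateWeight, if_neg (by omega), if_neg (by omega)]

lemma rowWeight_congr (z : ℝ) {S T A B S' T' A' B' : Finset ℕ} {N : ℕ}
    (hS : ∀ n < N, n ∈ S ↔ n ∈ S') (hT : ∀ n < N, n ∈ T ↔ n ∈ T')
    (hA : ∀ n < N, n ∈ A ↔ n ∈ A') (hB : ∀ n < N, n ∈ B ↔ n ∈ B') (h : ℤ) :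
    rowWeight z S T A B N h = rowWeight z S' T' A' B' N h := by
  induction N generalizing h with
  | zero => rfl
  | succ N ih =>
    simp only [rowWeight, occ, hS N (by omega), hT N (by omega), hA N (by omega), hB N (by omega)]
    rw [ih (fun n hn ↦ hS n (by omega)) (fun n hn ↦ hT n (by omega))
      (fun n hn ↦ hA n (by omega)) (fun n hn ↦ hB n (by omega))]

/-- The two-row partition function with the `x`-row below the `y`-row, summed over the
intermediate configuration. -/
noncomputable def upDown (x y : ℝ) (α β : Finset ℕ) (N : ℕ) (h k : ℤ) : ℝ :=
  ∑ l ∈ (range N).powerset, rowWeight x α l α l N h * rowWeight y β l l β N k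

/-- The two-row partition function with the `y`-row below the `x`-row, summed over the
intermediate configuration. -/
noncomputable def downUp (x y : ℝ) (α β : Finset ℕ) (N : ℕ) (h k : ℤ) : ℝ :=
  ∑ m ∈ (range N).powerset, rowWeight y m α α m N h * rowWeight x m β m β N k

lemma upDown_succ (x y : ℝ) (α β : Finset ℕ) (N : ℕ) (h k : ℤ) :
    upDown x y α β (N + 1) h k =
      stateWeight x (h - occ α N) * stateWeight y (k - occ β N) * (if N ∈ β then 2 else 1) *
        upDown x y α β N (h - occ α N) (k - occ β N) +
      stateWeight x (h + 1 - occ α N) * stateWeight y (k + 1 - occ β N) *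
        (if N ∈ α then 1 else 2) * upDown x y α β N (h + 1 - occ α N) (k + 1 - occ β N) := by
  rw [upDown, range_add_one, sum_powerset_insert notMem_range_self, upDown, upDown, mul_sum, mul_sum]
  congr 1 <;> refine sum_congr rfl fun l hl ↦ ?_
  · have hN : N ∉ l := fun h ↦ notMem_range_self (mem_powerset.1 hl h)
    simp only [rowWeight, occ, hN, if_false, false_and, not_false_eq_true, and_true, add_zero]
    ring_nf
  · have e (n) (hn : n < N) : n ∈ insert N l ↔ n ∈ l := by simp [hn.ne]
    simp only [rowWeight, occ, mem_insert_self, true_and, not_true, and_false]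
    rw [rowWeight_congr x (fun _ _ ↦ Iff.rfl) e (fun _ _ ↦ Iff.rfl) e,
      rowWeight_congr y (fun _ _ ↦ Iff.rfl) e e (fun _ _ ↦ Iff.rfl)]
    by_cases ha : N ∈ α <;> by_cases hb : N ∈ β <;> simp only [ha, hb, if_true, if_false, not_true, not_false_eq_true] <;> ring

lemma downUp_succ (x y : ℝ) (α β : Finset ℕ) (N : ℕ) (h k : ℤ) :
    downUp x y α β (N + 1) h k =
      stateWeight y (h + occ α N) * stateWeight x (k + occ β N) * (if N ∈ β then 2 else 1) *
        downUp x y α β N (h + occ α N) (k + occ β N) +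
      stateWeight y (h + occ α N - 1) * stateWeight x (k + occ β N - 1) *
        (if N ∈ α then 1 else 2) * downUp x y α β N (h + occ α N - 1) (k + occ β N - 1) := by
  rw [downUp, range_add_one, sum_powerset_insert notMem_range_self, downUp, downUp, mul_sum, mul_sum]
  congr 1 <;> refine sum_congr rfl fun l hl ↦ ?_
  · have hN : N ∉ l := fun h ↦ notMem_range_self (mem_powerset.1 hl h)
    simp only [rowWeight, occ, hN, if_false, false_and, not_false_eq_true, and_true, sub_zero]
    ring_nf
  · have e (n) (hn : n < N) : n ∈ insert N l ↔ n ∈ l := by simp [hn.ne]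
    simp only [rowWeight, occ, mem_insert_self, true_and, not_true, and_false]
    rw [rowWeight_congr y e (fun _ _ ↦ Iff.rfl) (fun _ _ ↦ Iff.rfl) e,
      rowWeight_congr x e (fun _ _ ↦ Iff.rfl) e (fun _ _ ↦ Iff.rfl)]
    by_cases ha : N ∈ α <;> by_cases hb : N ∈ β <;> simp only [ha, hb, if_true, if_false, not_true, not_false_eq_true] <;> ring

/-- The intertwining relations between the two orders of a pair of rows. -/
lemma upDown_intertwine {x y : ℝ} (hxy : 1 + x * y ≠ 0) (α β : Finset ℕ) (N : ℕ) :
    upDown x y α β N 1 0 = downUp x y α β N 0 1 ∧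
    upDown x y α β N 0 1 = downUp x y α β N 1 0 ∧
    (1 + x * y) * upDown x y α β N 0 0 =
      (1 - x * y) * downUp x y α β N 0 0 + 2 * (x * y) * downUp x y α β N 1 1 ∧
    (1 + x * y) * upDown x y α β N 1 1 =
      2 * downUp x y α β N 0 0 - (1 - x * y) * downUp x y α β N 1 1 := by
  induction N with
  | zero => simp [upDown, downUp, rowWeight]; constructor <;> ring
  | succ N ih =>
    obtain ⟨h1, h2, h3, h4⟩ := ih
    simp only [upDown_succ, downUp_succ]
    have h5 : upDown x y α β N 0 0 + x * y * upDown x y α β N 1 1 =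
        downUp x y α β N 0 0 + x * y * downUp x y α β N 1 1 := by
      refine mul_left_cancel₀ hxy ?_
      linear_combination h3 + x * y * h4
    by_cases ha : N ∈ α <;> by_cases hb : N ∈ β <;>
      simp only [occ, stateWeight, ha, hb, if_true, if_false] <;> norm_num
    · exact ⟨Or.inl h1, Or.inl h2, by linear_combination h3,
        by linear_combination 2 * h3 + x * y * h4⟩
    · exact ⟨by linear_combination h5, by linear_combination (1 + x * y) * y * h2,
        by linear_combination (1 + x * y) * y * h2⟩
    · exact ⟨by linear_combination 2 * h5, by linear_combination (1 + x * y) * 2 * x * h1,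
        by linear_combination (1 + x * y) * 2 * x * h1⟩
    · exact ⟨Or.inl h1, Or.inl h2, by linear_combination h3 + 2 * x * y * h4,
        by linear_combination x * y * h4⟩

lemma downUp_succ_of_subset (x y : ℝ) {α β : Finset ℕ} {N : ℕ} (hα : α ⊆ range N)
    (hβ : β ⊆ range N) :
    downUp x y α β (N + 1) 0 0 = downUp x y α β N 0 0 ∧
    downUp x y α β (N + 1) 1 1 = x * y * downUp x y α β N 1 1 + 2 * downUp x y α β N 0 0 := by
  have ha : N ∉ α := fun h ↦ notMem_range_self (hα h)
  have hb : N ∉ β := fun h ↦ notMem_range_self (hβ h)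
  constructor <;> rw [downUp_succ] <;> simp [occ, stateWeight, ha, hb]
  exact Or.inl (mul_comm y x)

lemma tendsto_downUp_zero (x y : ℝ) {α β : Finset ℕ} {N : ℕ} (hα : α ⊆ range N)
    (hβ : β ⊆ range N) :
    Filter.Tendsto (fun n ↦ downUp x y α β n 0 0) Filter.atTop (nhds (downUp x y α β N 0 0)) := by
  refine tendsto_atTop_of_eventually_const (i₀ := N) fun n hn ↦ ?_
  induction n, hn using Nat.le_induction with
  | base => rfl
  | succ n hn ih =>
    have hr := range_mono hn
    rw [(downUp_succ_of_subset x y (hα.trans hr) (hβ.trans hr)).1, ih]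

lemma tendsto_downUp_one {x y : ℝ} (h0 : 0 ≤ x * y) (h1 : x * y < 1) {α β : Finset ℕ} {N : ℕ}
    (hα : α ⊆ range N) (hβ : β ⊆ range N) :
    Filter.Tendsto (fun n ↦ downUp x y α β n 1 1) Filter.atTop
      (nhds (2 * downUp x y α β N 0 0 / (1 - x * y))) := by
  have hne : 1 - x * y ≠ 0 := by linarith
  set L := 2 * downUp x y α β N 0 0 / (1 - x * y) with hL
  have hL' : L * (1 - x * y) = 2 * downUp x y α β N 0 0 := div_mul_cancel₀ _ hne
  have key (k : ℕ) : downUp x y α β (k + N) 0 0 = downUp x y α β N 0 0 ∧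
      downUp x y α β (k + N) 1 1 = (x * y) ^ k * (downUp x y α β N 1 1 - L) + L := by
    induction k with
    | zero => simp
    | succ k ih =>
      have hr := range_mono (Nat.le_add_left N k)
      obtain ⟨e0, e1⟩ := downUp_succ_of_subset x y (hα.trans hr) (hβ.trans hr)
      rw [add_right_comm, e0, e1, ih.1, ih.2]
      exact ⟨rfl, by linear_combination -hL'⟩
  rw [← Filter.tendsto_add_atTop_iff_nat N]
  simp_rw [fun k ↦ (key k).2]
  simpa using ((tendsto_pow_atTop_nhds_zero_of_lt_one h0 h1).mul_const
    (downUp x y α β N 1 1 - L)).add_const L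

lemma tendsto_upDown_zero {x y : ℝ} (h0 : 0 ≤ x * y) (h1 : x * y < 1) {α β : Finset ℕ} {N : ℕ}
    (hα : α ⊆ range N) (hβ : β ⊆ range N) :
    Filter.Tendsto (fun n ↦ upDown x y α β n 0 0) Filter.atTop
      (nhds ((1 + x * y) / (1 - x * y) * downUp x y α β N 0 0)) := by
  have hp : 1 + x * y ≠ 0 := by linarith
  have hm : 1 - x * y ≠ 0 := by linarith
  have h (n) : upDown x y α β n 0 0 = ((1 - x * y) * downUp x y α β n 0 0 +
      2 * (x * y) * downUp x y α β n 1 1) / (1 + x * y) := by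
    rw [eq_div_iff hp, mul_comm, (upDown_intertwine hp α β n).2.2.1]
  simp_rw [h]
  convert (((tendsto_downUp_zero x y hα hβ).const_mul (1 - x * y)).add
    ((tendsto_downUp_one h0 h1 hα hβ).const_mul (2 * (x * y)))).div_const (1 + x * y) using 2
  field_simp
  ring

lemma upWeight_nonneg {z : ℝ} (hz : 0 ≤ z) (S T : Finset ℕ) : 0 ≤ upWeight z S T := by
  rw [upWeight]; positivity

lemma downWeight_nonneg {z : ℝ} (hz : 0 ≤ z) (S T : Finset ℕ) : 0 ≤ downWeight z S T := by
  rw [downWeight]; positivity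

lemma upDown_eq_sum (x y : ℝ) {α β : Finset ℕ} {N : ℕ} (hα : α ⊆ range N) (hβ : β ⊆ range N) :
    upDown x y α β N 0 0 = ∑ l ∈ (range N).powerset, upWeight x α l * downWeight y l β := by
  refine sum_congr rfl fun l hl ↦ ?_
  have hl := mem_powerset.1 hl
  rw [rowWeight_zero x hα hl hl, rowWeight_zero y hβ hl hβ, upWeight, downWeight]

lemma downUp_eq_sum (x y : ℝ) {α β : Finset ℕ} {N : ℕ} (hα : α ⊆ range N) (hβ : β ⊆ range N) :
    downUp x y α β N 0 0 = ∑ m ∈ (range N).powerset, downWeight y α m * upWeight x m β := by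
  refine sum_congr rfl fun l hl ↦ ?_
  have hl := mem_powerset.1 hl
  rw [rowWeight_zero x hl hβ hβ, rowWeight_zero y hl hα hl, upWeight, downWeight]

lemma tsum_finset_eq_ofReal {f : Finset ℕ → ℝ} (hf : ∀ S, 0 ≤ f S) {L : ℝ}
    (h : Filter.Tendsto (fun n ↦ ∑ S ∈ (range n).powerset, f S) Filter.atTop (nhds L)) :
    ∑' S, ENNReal.ofReal (f S) = ENNReal.ofReal L := by
  have hs (t : Finset (Finset ℕ)) : ∃ n : ℕ, t ⊆ (range n).powerset := by
    refine ⟨(t.sup id).sup id + 1, fun S hS ↦ mem_powerset.2 fun m hm ↦ mem_range.2 ?_⟩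
    have h1 : S ≤ t.sup id := le_sup (f := id) hS
    exact Nat.lt_succ_of_le (le_sup (f := id) (h1 hm))
  rw [ENNReal.tsum_eq_iSup_sum' _ hs]
  refine tendsto_nhds_unique (tendsto_atTop_iSup fun m n hmn ↦
    sum_le_sum_of_subset (powerset_mono.2 (range_mono hmn))) ?_
  simp_rw [← ENNReal.ofReal_sum_of_nonneg fun S _ ↦ hf S]
  exact ENNReal.tendsto_ofReal h

/-- The skew Cauchy identity for one-variable Schur `Q`-functions. -/
lemma tsum_upWeight_mul_downWeight {x y : ℝ} (hx : 0 ≤ x) (hy : 0 ≤ y) (h1 : x * y < 1)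
    (α β : Finset ℕ) :
    ∑' l, ENNReal.ofReal (upWeight x α l) * ENNReal.ofReal (downWeight y l β) =
      ENNReal.ofReal ((1 + x * y) / (1 - x * y)) *
        ∑' m, ENNReal.ofReal (downWeight y α m) * ENNReal.ofReal (upWeight x m β) := by
  have h0 : 0 ≤ x * y := mul_nonneg hx hy
  have hc : 0 ≤ (1 + x * y) / (1 - x * y) := div_nonneg (by linarith) (by linarith)
  obtain ⟨N, hα, hβ⟩ : ∃ N, α ⊆ range N ∧ β ⊆ range N := by
    refine ⟨(α ∪ β).sup id + 1, fun m hm ↦ ?_, fun m hm ↦ ?_⟩ <;>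
    exact mem_range.2 (Nat.lt_succ_of_le (le_sup (f := id) (by simp [hm])))
  simp_rw [← ENNReal.ofReal_mul (upWeight_nonneg hx _ _),
    ← ENNReal.ofReal_mul (downWeight_nonneg hy _ _)]
  rw [tsum_finset_eq_ofReal
      (fun l ↦ mul_nonneg (upWeight_nonneg hx _ _) (downWeight_nonneg hy _ _))
      (Filter.Tendsto.congr' ?_ (tendsto_upDown_zero h0 h1 hα hβ)),
    tsum_finset_eq_ofReal
      (fun l ↦ mul_nonneg (downWeight_nonneg hy _ _) (upWeight_nonneg hx _ _))
      (Filter.Tendsto.congr' ?_ (tendsto_downUp_zero x y hα hβ)), ENNReal.ofReal_mul hc]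
  · filter_upwards [Filter.eventually_ge_atTop N] with n hn
    exact downUp_eq_sum x y (hα.trans (range_mono hn)) (hβ.trans (range_mono hn))
  · filter_upwards [Filter.eventually_ge_atTop N] with n hn
    exact upDown_eq_sum x y (hα.trans (range_mono hn)) (hβ.trans (range_mono hn))

/-- The sum over paths of finsets from `S` to `∅` whose successive steps are weighted by the
entries of a list. -/
noncomputable def pathSum : List (Finset ℕ → Finset ℕ → ENNReal) → Finset ℕ → ENNReal
  | [], S => if S = ∅ then 1 else 0
  | w :: L, S => ∑' T, w S T * pathSum L T

/-- `upWeight` with values in `ENNReal`. -/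
noncomputable def upStep (z : ℝ) (S T : Finset ℕ) : ENNReal := ENNReal.ofReal (upWeight z S T)

/-- `downWeight` with values in `ENNReal`. -/
noncomputable def downStep (z : ℝ) (S T : Finset ℕ) : ENNReal := ENNReal.ofReal (downWeight z S T)

/-- The Cauchy factor of a pair of variables. -/
noncomputable def cauchyFactor (x y : ℝ) : ENNReal := ENNReal.ofReal ((1 + x * y) / (1 - x * y))

lemma pathSum_up_down {x y : ℝ} (hx : 0 ≤ x) (hy : 0 ≤ y) (h1 : x * y < 1)
    (L : List (Finset ℕ → Finset ℕ → ENNReal)) (S : Finset ℕ) :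
    pathSum (upStep x :: downStep y :: L) S =
      cauchyFactor x y * pathSum (downStep y :: upStep x :: L) S := by
  simp only [pathSum, ← ENNReal.tsum_mul_left]
  rw [ENNReal.tsum_comm]
  conv_rhs => rw [ENNReal.tsum_comm]
  refine tsum_congr fun T ↦ ?_
  simp_rw [← mul_assoc, ENNReal.tsum_mul_right]
  congr 1
  simp_rw [mul_assoc, ENNReal.tsum_mul_left]
  exact tsum_upWeight_mul_downWeight hx hy h1 S T

lemma pathSum_ups_down {xs : List ℝ} {y : ℝ} (hxs : ∀ x ∈ xs, 0 ≤ x ∧ x * y < 1) (hy : 0 ≤ y)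
    (L : List (Finset ℕ → Finset ℕ → ENNReal)) (S : Finset ℕ) :
    pathSum (xs.map upStep ++ downStep y :: L) S =
      (xs.map (cauchyFactor · y)).prod * pathSum (downStep y :: (xs.map upStep ++ L)) S := by
  induction xs generalizing S with
  | nil => simp
  | cons x xs ih =>
    rw [List.forall_mem_cons] at hxs
    rw [List.map_cons, List.cons_append, pathSum]
    simp_rw [ih hxs.2, fun T p q ↦ mul_left_comm (upStep x S T) p q, ENNReal.tsum_mul_left]
    rw [← pathSum, pathSum_up_down hxs.1.1 hy hxs.1.2, List.map_cons, List.prod_cons,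
      List.cons_append]
    ring

lemma tailCard_empty (n : ℕ) : tailCard ∅ n = 0 := by simp [tailCard]

lemma interlace_empty_right {S : Finset ℕ} : Interlace S ∅ ↔ S = ∅ := by
  refine ⟨fun h ↦ ?_, fun h n ↦ by simp [h]⟩
  have := (h 0).1
  simpa [tailCard] using this

lemma upStep_empty_right (z : ℝ) (S : Finset ℕ) : upStep z S ∅ = if S = ∅ then 1 else 0 := by
  by_cases h : S = ∅ <;> simp [upStep, upWeight, interlace_empty_right, h]

lemma downStep_empty_left (z : ℝ) (T : Finset ℕ) : downStep z ∅ T = if T = ∅ then 1 else 0 := by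
  by_cases h : T = ∅ <;> simp [downStep, downWeight, interlace_empty_right, h]

lemma pathSum_down_empty (y : ℝ) (L : List (Finset ℕ → Finset ℕ → ENNReal)) :
    pathSum (downStep y :: L) ∅ = pathSum L ∅ := by
  simp [pathSum, downStep_empty_left]

lemma pathSum_ups (xs : List ℝ) (S : Finset ℕ) :
    pathSum (xs.map upStep) S = if S = ∅ then 1 else 0 := by
  induction xs generalizing S with
  | nil => rfl
  | cons x xs ih => simp [pathSum, ih, upStep_empty_right]

/-- The Cauchy identity for Schur `Q`-functions. -/
lemma pathSum_ups_downs {xs ys : List ℝ} (hxs : ∀ x ∈ xs, 0 ≤ x) (hys : ∀ y ∈ ys, 0 ≤ y)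
    (h1 : ∀ x ∈ xs, ∀ y ∈ ys, x * y < 1) :
    pathSum (xs.map upStep ++ ys.map downStep) ∅ =
      (ys.map fun y ↦ (xs.map (cauchyFactor · y)).prod).prod := by
  induction ys with
  | nil => simp [pathSum_ups]
  | cons y ys ih =>
    simp only [List.forall_mem_cons] at hys h1
    rw [List.map_cons, pathSum_ups_down (fun x hx ↦ ⟨hxs x hx, (h1 x hx).1⟩) hys.1,
      pathSum_down_empty, ih hys.2 fun x hx ↦ (h1 x hx).2, List.map_cons, List.prod_cons]

lemma pathSum_range (w : ℕ → Finset ℕ → Finset ℕ → ENNReal) (n : ℕ) (S : Finset ℕ) :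
    pathSum ((List.range n).map w) S = ∑' f : Fin n → Finset ℕ,
      if (Fin.cons S f : Fin (n + 1) → Finset ℕ) (Fin.last n) = ∅ then
        ∏ i : Fin n, w i ((Fin.cons S f : Fin (n + 1) → Finset ℕ) i.castSucc) (f i) else 0 := by
  induction n generalizing w S with
  | zero => simp [pathSum]
  | succ n ih =>
    rw [List.range_succ_eq_map, List.map_cons, List.map_map, pathSum,
      ← (Fin.consEquiv fun _ : Fin (n + 1) ↦ Finset ℕ).tsum_eq, ENNReal.tsum_prod']
    refine tsum_congr fun T ↦ ?_
    rw [ih, ← ENNReal.tsum_mul_left]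
    refine tsum_congr fun f ↦ ?_
    rw [← Fin.succ_last, Fin.cons_succ, mul_ite, mul_zero, Fin.prod_univ_succ]
    simp [Fin.consEquiv]

lemma prod_map_range {M : Type*} [CommMonoid M] (f : ℕ → M) (n : ℕ) :
    ((List.range n).map f).prod = ∏ i ∈ range n, f i := by
  induction n with
  | zero => simp
  | succ n ih => rw [List.range_succ, List.map_append, List.prod_append, ih, prod_range_succ]; simp

/-- The step weights along the diagonals `-r, …, c` of a boxed plane partition. -/
noncomputable def stepWeight (x s : ℝ) (r k : ℕ) (S T : Finset ℕ) : ℝ :=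
  if k < r then upWeight (x * s ^ (r - k)) S T else downWeight (s ^ (k - r)) S T

lemma stepWeight_nonneg {x s : ℝ} (hx : 0 ≤ x) (hs : 0 ≤ s) (r k : ℕ) (S T : Finset ℕ) :
    0 ≤ stepWeight x s r k S T := by
  rw [stepWeight]
  split_ifs
  · exact upWeight_nonneg (by positivity) _ _
  · exact downWeight_nonneg (by positivity) _ _

lemma pathSum_stepWeight {x s : ℝ} (hx0 : 0 ≤ x) (hx1 : x < 1) (hs0 : 0 ≤ s) (hs1 : s < 1)
    (r c : ℕ) :
    pathSum ((List.range (r + c)).map fun k S T ↦ ENNReal.ofReal (stepWeight x s r k S T)) ∅ =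
      ENNReal.ofReal (∏ i ∈ range r, ∏ j ∈ range c,
        (1 + x * s ^ (i + j + 1)) / (1 - x * s ^ (i + j + 1))) := by
  have hlt (n : ℕ) : x * s ^ n < 1 :=
    (mul_le_of_le_one_right hx0 (pow_le_one₀ hs0 hs1.le)).trans_lt hx1
  have hL : ((List.range (r + c)).map fun k S T ↦ ENNReal.ofReal (stepWeight x s r k S T)) =
      ((List.range r).map fun k ↦ x * s ^ (r - k)).map upStep ++
        ((List.range c).map fun k ↦ s ^ k).map downStep := by
    rw [List.range_add, List.map_append, List.map_map, List.map_map, List.map_map]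
    congr 1
    · refine List.map_congr_left fun k hk ↦ ?_
      funext S T
      simp [stepWeight, upStep, List.mem_range.1 hk]
    · refine List.map_congr_left fun k hk ↦ ?_
      funext S T
      simp [stepWeight, downStep]
  rw [hL, pathSum_ups_downs]
  · rw [List.map_map, prod_map_range, prod_comm, ENNReal.ofReal_prod_of_nonneg]
    · refine prod_congr rfl fun j _ ↦ ?_
      rw [Function.comp_apply, List.map_map, prod_map_range, ← prod_range_reflect,
        ENNReal.ofReal_prod_of_nonneg]
      · refine prod_congr rfl fun i hi ↦ ?_
        have : r - (r - 1 - i) = i + 1 := by have := mem_range.1 hi; omega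
        rw [Function.comp_apply, cauchyFactor, this, mul_assoc, ← pow_add, add_right_comm]
      · exact fun i _ ↦ div_nonneg (by positivity) (by linarith [hlt (i + j + 1)])
    · exact fun j _ ↦ prod_nonneg fun i _ ↦
        div_nonneg (by positivity) (by linarith [hlt (i + j + 1)])
  · simp only [List.mem_map]
    rintro _ ⟨k, -, rfl⟩
    positivity
  · simp only [List.mem_map]
    rintro _ ⟨k, -, rfl⟩
    positivity
  · simp only [List.mem_map]
    rintro _ ⟨k, -, rfl⟩ _ ⟨l, -, rfl⟩
    rw [mul_assoc, ← pow_add]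
    exact hlt _

/-- The sequence `a` is strictly decreasing until it vanishes, and zero from then on. -/
def StrictSeq (a : ℕ → ℕ) : Prop := ∀ d, a (d + 1) ≤ a d - 1

/-- The sequence `a` lists the parts `m + 1`, for `m ∈ S`, in decreasing order. -/
def Encodes (a : ℕ → ℕ) (S : Finset ℕ) : Prop := ∀ d n, n < a d ↔ d < tailCard S n

open Classical in
/-- The finset `{a d - 1 | a d ≠ 0}` of a strict sequence `a`. -/
noncomputable def partSet (a : ℕ → ℕ) : Finset ℕ := {n ∈ range (a 0) | ∃ d, a d = n + 1}

/-- The decreasing sequence of the parts `m + 1`, for `m ∈ S`. -/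
noncomputable def partSeq (S : Finset ℕ) (d : ℕ) : ℕ := sInf {n | tailCard S n ≤ d}

lemma StrictSeq.le_sub {a : ℕ → ℕ} (ha : StrictSeq a) (d e : ℕ) : a (d + e) ≤ a d - e := by
  induction e with
  | zero => rfl
  | succ e ih => have := ha (d + e); rw [← add_assoc]; omega

lemma StrictSeq.lt {a : ℕ → ℕ} (ha : StrictSeq a) {d e : ℕ} (h : d < e) (hd : a d ≠ 0) :
    a e < a d := by
  have := ha.le_sub d (e - d)
  rw [Nat.add_sub_cancel' h.le] at this
  omega

lemma StrictSeq.antitone {a : ℕ → ℕ} (ha : StrictSeq a) : Antitone a :=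
  antitone_nat_of_succ_le fun d ↦ (ha d).trans (Nat.sub_le _ _)

lemma StrictSeq.eq_of_eq {a : ℕ → ℕ} (ha : StrictSeq a) {d e : ℕ} (hd : a d ≠ 0)
    (h : a d = a e) : d = e := by
  rcases lt_trichotomy d e with h' | h' | h'
  · have := ha.lt h' hd; omega
  · exact h'
  · have := ha.lt h' (h ▸ hd); omega

lemma StrictSeq.mem_partSet {a : ℕ → ℕ} (ha : StrictSeq a) {n : ℕ} :
    n ∈ partSet a ↔ ∃ d, a d = n + 1 := by
  simp only [partSet, mem_filter, mem_range, and_iff_right_iff_imp]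
  rintro ⟨d, hd⟩
  have := ha.antitone (Nat.zero_le d)
  omega

lemma StrictSeq.encodes {a : ℕ → ℕ} (ha : StrictSeq a) : Encodes a (partSet a) := by
  intro d n
  have hex : ∃ d, a d ≤ n := ⟨a 0, by have := ha.le_sub 0 (a 0); rw [zero_add] at this; omega⟩
  have hlt (e : ℕ) : n < a e ↔ e < Nat.find hex := by
    rw [Nat.lt_find_iff]
    exact ⟨fun h m hm ↦ by have := ha.antitone hm; omega, fun h ↦ not_le.1 (h e le_rfl)⟩
  have himg : ({m ∈ partSet a | n ≤ m} : Finset ℕ) =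
      (range (Nat.find hex)).image fun e ↦ a e - 1 := by
    ext m
    simp only [mem_filter, ha.mem_partSet, mem_image, mem_range, ← hlt]
    constructor
    · rintro ⟨⟨e, he⟩, hm⟩
      exact ⟨e, by omega, by omega⟩
    · rintro ⟨e, he, rfl⟩
      exact ⟨⟨e, by omega⟩, by omega⟩
  rw [hlt, tailCard, himg, card_image_of_injOn, card_range]
  intro e he e' he' h
  simp only [coe_range, Set.mem_Iio, ← hlt] at he he' h
  exact ha.eq_of_eq (by omega) (by omega)

lemma tailCard_antitone (S : Finset ℕ) : Antitone (tailCard S) := fun _ _ h ↦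
  card_le_card fun _ hm ↦ mem_filter.2 ⟨(mem_filter.1 hm).1, h.trans (mem_filter.1 hm).2⟩

lemma encodes_partSeq (S : Finset ℕ) : Encodes (partSeq S) S := by
  intro d n
  have hne : {n | tailCard S n ≤ d}.Nonempty := by
    refine ⟨S.sup id + 1, ?_⟩
    have hS : S ⊆ range (S.sup id + 1) := fun m hm ↦
      mem_range.2 (Nat.lt_succ_of_le (le_sup (f := id) hm))
    exact (tailCard_eq_zero hS le_rfl).trans_le (Nat.zero_le d)
  constructor
  · intro h
    by_contra! hc
    exact (Nat.sInf_le (s := {n | tailCard S n ≤ d}) hc).not_gt h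
  · intro h
    by_contra! hc
    have h1 : tailCard S (partSeq S d) ≤ d := Nat.sInf_mem hne
    have := tailCard_antitone S hc
    omega

lemma tailCard_succ_lt_iff {S : Finset ℕ} {n : ℕ} :
    n ∈ S ↔ tailCard S (n + 1) < tailCard S n := by
  have := tailCard_eq_succ S n
  rw [occ] at this
  split_ifs at this with h <;> simp only [h, true_iff, false_iff] <;> omega

namespace Encodes

variable {a b : ℕ → ℕ} {S T : Finset ℕ}

lemma strictSeq (h : Encodes a S) : StrictSeq a := by
  intro d
  by_contra! hc
  have h1 := tailCard_eq_succ S (a d)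
  have h2 := h d (a d)
  have h3 := tailCard_eq_succ S (a d - 1)
  have h4 := h (d + 1) (a d - 1)
  have h5 : occ S (a d - 1) ≤ 1 := by rw [occ]; split_ifs <;> simp
  rcases Nat.eq_zero_or_pos (a d) with h0 | h0
  · have := h d 0
    have := h (d + 1) 0
    omega
  · rw [Nat.sub_add_cancel h0] at h3
    omega

lemma finset_eq (h : Encodes a S) (h' : Encodes a T) : S = T := by
  have key (n) : tailCard S n = tailCard T n := by
    have h1 := (h (tailCard S n) n).symm.trans (h' _ n)
    have h2 := (h (tailCard T n) n).symm.trans (h' _ n)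
    omega
  ext n
  rw [tailCard_succ_lt_iff, tailCard_succ_lt_iff, key, key]

lemma interlace_iff (ha : Encodes a S) (hb : Encodes b T) :
    Interlace S T ↔ ∀ d, a d ≤ b d ∧ b (d + 1) ≤ a d := by
  constructor
  · intro h d
    constructor
    · by_contra! hc
      have h1 := ha d (b d)
      have h2 := hb d (b d)
      have h3 := h (b d)
      omega
    · by_contra! hc
      have h1 := ha d (a d)
      have h2 := hb (d + 1) (a d)
      have h3 := h (a d)
      omega
  · intro h n
    constructor
    · by_contra! hc
      have h1 := ha (tailCard T n) n
      have h2 := hb (tailCard T n) n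
      have h3 := h (tailCard T n)
      omega
    · by_contra! hc
      have h1 := ha (tailCard S n) n
      have h2 := hb (tailCard S n + 1) n
      have h3 := h (tailCard S n)
      omega

end Encodes

lemma partSet_eq_image {a : ℕ → ℕ} (ha : StrictSeq a) {M : ℕ} (hM : ∀ d, M ≤ d → a d = 0) :
    partSet a = ({d ∈ range M | a d ≠ 0} : Finset ℕ).image fun d ↦ a d - 1 := by
  ext m
  simp only [ha.mem_partSet, mem_image, mem_filter, mem_range]
  constructor
  · rintro ⟨d, hd⟩
    have : d < M := by by_contra! hc; have := hM d hc; omega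
    exact ⟨d, ⟨this, by omega⟩, by omega⟩
  · rintro ⟨d, hd, rfl⟩
    exact ⟨d, by omega⟩

lemma StrictSeq.injOn {a : ℕ → ℕ} (ha : StrictSeq a) {s : Set ℕ} (hs : ∀ d ∈ s, a d ≠ 0) :
    Set.InjOn (fun d ↦ a d - 1) s := by
  intro d hd e he h
  have h1 := hs d hd
  have h2 := hs e he
  simp only at h
  exact ha.eq_of_eq h1 (by omega)

lemma partSize_partSet {a : ℕ → ℕ} (ha : StrictSeq a) {M : ℕ} (hM : ∀ d, M ≤ d → a d = 0) :
    partSize (partSet a) = ∑ d ∈ range M, a d := by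
  rw [partSet_eq_image ha hM, partSize, sum_image (ha.injOn (by simp)),
    ← sum_filter_ne_zero (s := range M)]
  refine sum_congr rfl fun d hd ↦ ?_
  have := (mem_filter.1 hd).2
  omega

lemma Interlace.partSize_le {S T : Finset ℕ} (h : Interlace S T) : partSize S ≤ partSize T := by
  obtain ⟨N, hS, hT⟩ : ∃ N, S ⊆ range N ∧ T ⊆ range N := by
    refine ⟨(S ∪ T).sup id + 1, fun m hm ↦ ?_, fun m hm ↦ ?_⟩ <;>
    exact mem_range.2 (Nat.lt_succ_of_le (le_sup (f := id) (by simp [hm])))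
  rw [← sum_tailCard hS, ← sum_tailCard hT]
  exact sum_le_sum fun n _ ↦ (h n).1

/-- The weight of a path of strict partitions, in terms of the number of new parts and the sizes
of the partitions along the path. -/
lemma prod_stepWeight (x s : ℝ) {r c : ℕ} {P : ℕ → Finset ℕ} (h0 : P 0 = ∅) (h1 : P (r + c) = ∅)
    (hup : ∀ k < r, Interlace (P k) (P (k + 1)))
    (hdown : ∀ k, r ≤ k → k < r + c → Interlace (P (k + 1)) (P k)) :
    ∏ k ∈ range (r + c), stepWeight x s r k (P k) (P (k + 1)) =
      2 ^ (∑ k ∈ range (r + c), #(P (k + 1) \ P k)) * x ^ partSize (P r) *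
        s ^ ∑ k ∈ range (r + c + 1), partSize (P k) := by
  have hU (m : ℕ) (hm : m ≤ r) : ∏ k ∈ range m, stepWeight x s r k (P k) (P (k + 1)) =
      2 ^ (∑ k ∈ range m, #(P (k + 1) \ P k)) * x ^ partSize (P m) *
        s ^ ((r - m) * partSize (P m) + ∑ k ∈ range (m + 1), partSize (P k)) := by
    induction m with
    | zero => simp [h0, partSize]
    | succ m ih =>
      have hi := hup m hm
      obtain ⟨t, ht⟩ := Nat.exists_eq_add_of_le hi.partSize_le
      obtain ⟨u, hu⟩ : ∃ u, r = m + 1 + u := Nat.exists_eq_add_of_le hm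
      rw [prod_range_succ, ih (by omega), stepWeight, if_pos (by omega), upWeight, if_pos hi, ht, Nat.add_sub_cancel_left, mul_pow,
        ← pow_mul, show r - m = u + 1 by omega, show r - (m + 1) = u by omega]
      simp only [sum_range_succ, ht]
      ring
  have hD (m : ℕ) (hm : m ≤ c) :
      (∏ k ∈ range m, stepWeight x s r (r + k) (P (r + k)) (P (r + k + 1))) *
        s ^ (m * partSize (P (r + m))) =
      2 ^ (∑ k ∈ range m, #(P (r + k + 1) \ P (r + k))) *
        s ^ (∑ k ∈ range m, partSize (P (r + k + 1))) := by
    induction m with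
    | zero => simp
    | succ m ih =>
      have hi := hdown (r + m) (by omega) (by omega)
      obtain ⟨t, ht⟩ := Nat.exists_eq_add_of_le hi.partSize_le
      have ih := ih (by omega)
      rw [prod_range_succ, sum_range_succ, sum_range_succ, pow_add, pow_add, mul_mul_mul_comm, ← ih,
        stepWeight, if_neg (by omega), downWeight, if_pos hi, ht, Nat.add_sub_cancel_left,
        ← pow_mul, Nat.add_sub_cancel_left, ← add_assoc]
      ring
  have hD := hD c le_rfl
  rw [h1, show partSize ∅ = 0 from rfl, mul_zero, pow_zero, mul_one] at hD
  rw [prod_range_add, hU r le_rfl, hD, sum_range_add _ r c, show r + c + 1 = (r + 1) + c by ring,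
    sum_range_add _ (r + 1) c, sum_range_succ _ r, tsub_self, zero_mul, zero_add, pow_add, pow_add]
  simp only [add_right_comm r 1]
  ring

/-- A step to the right or upwards between boxes with the same nonzero entry. -/
def ForwardStep (g : ℕ → ℕ → ℕ) (p q : ℕ × ℕ) : Prop :=
  ((p.1 = q.1 ∧ p.2 + 1 = q.2) ∨ (p.2 = q.2 ∧ q.1 + 1 = p.1)) ∧
    g p.1 p.2 = g q.1 q.2 ∧ g p.1 p.2 ≠ 0

/-- The box `p` is the bottom-left end of its connected component: it has no equal neighbour on
its left or below it. -/
def IsStart (g : ℕ → ℕ → ℕ) (p : ℕ × ℕ) : Prop :=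
  g p.1 p.2 ≠ 0 ∧ ∀ q, ¬ ForwardStep g q p

lemma connStep_iff {g : ℕ → ℕ → ℕ} {p q : ℕ × ℕ} :
    ConnStep g p q ↔ ForwardStep g p q ∨ ForwardStep g q p := by
  unfold ConnStep ForwardStep Adjacent
  grind

lemma ConnStep.symm {g : ℕ → ℕ → ℕ} {p q : ℕ × ℕ} (h : ConnStep g p q) : ConnStep g q p := by
  rw [connStep_iff] at h ⊢
  exact h.symm

lemma sameComponent_set_eq {g : ℕ → ℕ → ℕ} {p q : ℕ × ℕ} (h : SameComponent g p q)
    (hq : g q.1 q.2 ≠ 0) : {u | SameComponent g p u} = {u | SameComponent g q u} := by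
  ext u
  have hs : Relation.ReflTransGen (ConnStep g) q p :=
    Relation.reflTransGen_swap.1 (Relation.ReflTransGen.mono
      (show ConnStep g ≤ Function.swap (ConnStep g) from fun _ _ h ↦ h.symm) _ _ h.2)
  exact ⟨fun hu ↦ ⟨hq, hs.trans hu.2⟩, fun hu ↦ ⟨h.1, h.2.trans hu.2⟩⟩

namespace PlanePartition

variable {π : PlanePartition}

lemma IsStrict.forwardStep_unique (hπ : π.IsStrict) {p q u : ℕ × ℕ}
    (hp : ForwardStep π.part p u) (hq : ForwardStep π.part q u) : p = q := by
  obtain ⟨p1, p2⟩ := p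
  obtain ⟨q1, q2⟩ := q
  obtain ⟨u1, u2⟩ := u
  simp only [ForwardStep] at hp hq
  obtain ⟨h1 | h1, h2, h3⟩ := hp <;> obtain ⟨h1' | h1', h2', h3'⟩ := hq
  · grind
  · have := hπ p1 p2 h3
    rw [show p1 + 1 = q1 by omega, show p2 + 1 = q2 by omega] at this
    omega
  · have := hπ q1 q2 h3'
    rw [show q1 + 1 = p1 by omega, show q2 + 1 = p2 by omega] at this
    omega
  · grind

lemma IsStrict.forward_of_isStart (hπ : π.IsStrict) {p q : ℕ × ℕ} (hp : IsStart π.part p)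
    (h : Relation.ReflTransGen (ConnStep π.part) p q) :
    Relation.ReflTransGen (ForwardStep π.part) p q := by
  induction h with
  | refl => exact .refl
  | @tail u v _ huv ih =>
    rcases connStep_iff.1 huv with h | h
    · exact ih.tail h
    · rcases ih.cases_tail with rfl | ⟨w, hw, hwu⟩
      · exact absurd h (hp.2 v)
      · exact hπ.forwardStep_unique hwu h ▸ hw

lemma IsStrict.isStart_unique (hπ : π.IsStrict) {p q : ℕ × ℕ} (hp : IsStart π.part p)
    (hq : IsStart π.part q) (h : SameComponent π.part p q) : p = q := by
  rcases (hπ.forward_of_isStart hp h.2).cases_tail with rfl | ⟨w, -, hw⟩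
  · rfl
  · exact absurd hw (hq.2 w)

lemma exists_isStart {r : ℕ} (hr : ∀ i j, r ≤ i → π.part i j = 0) (p : ℕ × ℕ)
    (hp : π.part p.1 p.2 ≠ 0) :
    ∃ q, IsStart π.part q ∧ Relation.ReflTransGen (ConnStep π.part) p q := by
  by_cases h : IsStart π.part p
  · exact ⟨p, h, .refl⟩
  · obtain ⟨u, hu⟩ : ∃ u, ForwardStep π.part u p := by simpa [IsStart, hp] using h
    have hur : u.1 < r := by
      by_contra! hc
      exact hu.2.2 (hr _ _ hc)
    have hpr : p.1 < r := by
      by_contra! hc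
      exact hp (hr _ _ hc)
    have : u.2 + (r - u.1) < p.2 + (r - p.1) := by
      rcases hu.1 with h | h <;> omega
    obtain ⟨q, hq, hqu⟩ := exists_isStart hr u hu.2.2
    exact ⟨q, hq, .head (connStep_iff.2 (.inr hu)) hqu⟩
termination_by p.2 + (r - p.1)

/-- Each connected component of a strict plane partition has exactly one bottom-left end. -/
lemma IsStrict.numComponents_eq (hπ : π.IsStrict) {r : ℕ}
    (hr : ∀ i j, r ≤ i → π.part i j = 0) :
    numComponents π.part = {p | IsStart π.part p}.ncard := by
  have himg : components π.part =
      (fun p ↦ {q | SameComponent π.part p q}) '' {p | IsStart π.part p} := by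
    ext C
    constructor
    · rintro ⟨p, hp, rfl⟩
      obtain ⟨q, hq, hpq⟩ := exists_isStart hr p hp
      exact ⟨q, hq, (sameComponent_set_eq ⟨hp, hpq⟩ hq.1).symm⟩
    · rintro ⟨p, hp, rfl⟩
      exact ⟨p, hp.1, rfl⟩
  rw [numComponents, himg, Set.InjOn.ncard_image]
  intro p hp q hq h
  have : q ∈ {u | SameComponent π.part p u} := by
    rw [show {u | SameComponent π.part p u} = {u | SameComponent π.part q u} from h]
    exact ⟨hq.1, .refl⟩
  exact hπ.isStart_unique hp hq this

/-- The diagonal of content `k - r`. -/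
def diag (π : PlanePartition) (r k d : ℕ) : ℕ := π.part (d + (r - k)) (d + (k - r))

lemma IsStrict.strictSeq_diag (hπ : π.IsStrict) (r k : ℕ) : StrictSeq (π.diag r k) := by
  intro d
  have h1 := hπ (d + (r - k)) (d + (k - r))
  have h2 := (π.row_decr (d + (r - k) + 1) (d + (k - r))).trans (π.col_decr _ _)
  rw [diag, diag, add_right_comm, add_right_comm d 1]
  omega

lemma diag_up {r k : ℕ} (h : k < r) (d : ℕ) :
    π.diag r k d ≤ π.diag r (k + 1) d ∧ π.diag r (k + 1) (d + 1) ≤ π.diag r k d := by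
  simp only [diag]
  rw [show r - k = (r - (k + 1)) + 1 by omega, show k - r = 0 by omega,
    show k + 1 - r = 0 by omega, ← add_assoc, add_right_comm d 1]
  exact ⟨π.col_decr _ _, π.row_decr _ _⟩

lemma diag_down {r k : ℕ} (h : r ≤ k) (d : ℕ) :
    π.diag r (k + 1) d ≤ π.diag r k d ∧ π.diag r k (d + 1) ≤ π.diag r (k + 1) d := by
  simp only [diag]
  rw [show k + 1 - r = (k - r) + 1 by omega, show r - k = 0 by omega,
    show r - (k + 1) = 0 by omega, ← add_assoc, add_right_comm d 1 0, add_right_comm d 1 (k - r)]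
  exact ⟨π.row_decr _ _, π.col_decr _ _⟩

/-- Membership in `SP(r, c)`. -/
def IsBoxed (r c : ℕ) (π : PlanePartition) : Prop := ∀ i j, r ≤ i ∨ c ≤ j → π.part i j = 0

/-- The strict partition along the diagonal of content `k - r`, as a finset. -/
noncomputable def diagSet (π : PlanePartition) (r k : ℕ) : Finset ℕ := partSet (π.diag r k)

lemma IsStrict.encodes_diag (hπ : π.IsStrict) (r k : ℕ) :
    Encodes (π.diag r k) (π.diagSet r k) := (hπ.strictSeq_diag r k).encodes

lemma IsStrict.interlace_up (hπ : π.IsStrict) {r k : ℕ} (h : k < r) :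
    Interlace (π.diagSet r k) (π.diagSet r (k + 1)) :=
  ((hπ.encodes_diag r k).interlace_iff (hπ.encodes_diag r (k + 1))).2 fun d ↦ diag_up h d

lemma IsStrict.interlace_down (hπ : π.IsStrict) {r k : ℕ} (h : r ≤ k) :
    Interlace (π.diagSet r (k + 1)) (π.diagSet r k) :=
  ((hπ.encodes_diag r (k + 1)).interlace_iff (hπ.encodes_diag r k)).2 fun d ↦ diag_down h d

lemma partSet_zero : partSet (fun _ ↦ 0) = ∅ := by simp [partSet]

variable {r c : ℕ}

lemma IsBoxed.diag_eq_zero (hb : π.IsBoxed r c) {k d : ℕ} (hd : r + c ≤ d) :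
    π.diag r k d = 0 := hb _ _ (by omega)

lemma IsBoxed.diagSet_zero (hb : π.IsBoxed r c) : π.diagSet r 0 = ∅ := by
  rw [diagSet, show π.diag r 0 = fun _ ↦ 0 from funext fun d ↦ hb _ _ (by omega), partSet_zero]

lemma IsBoxed.diagSet_last (hb : π.IsBoxed r c) : π.diagSet r (r + c) = ∅ := by
  rw [diagSet, show π.diag r (r + c) = fun _ ↦ 0 from funext fun d ↦ hb _ _ (by omega),
    partSet_zero]

lemma sum_box_eq_sum_diag {h : ℕ → ℕ → ℕ} (hh : ∀ i j, r ≤ i ∨ c ≤ j → h i j = 0) :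
    ∑ p ∈ range r ×ˢ range c, h p.1 p.2 =
      ∑ k ∈ range (r + c + 1), ∑ d ∈ range (r + c), h (d + (r - k)) (d + (k - r)) := by
  rw [← sum_product' (range (r + c + 1)) (range (r + c))
    fun k d ↦ h (d + (r - k)) (d + (k - r))]
  refine sum_of_injOn (fun p ↦ (p.2 + r - p.1, min p.1 p.2)) ?_ ?_ ?_ ?_
  · rintro ⟨i, j⟩ hp ⟨i', j'⟩ hp' he
    simp only [coe_product, Set.mem_prod, coe_range, Set.mem_Iio, Prod.mk.injEq] at *
    omega
  · rintro ⟨i, j⟩ hp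
    simp only [coe_product, Set.mem_prod, coe_range, Set.mem_Iio] at *
    omega
  · rintro ⟨k, d⟩ - hn
    by_contra hc
    refine hn ⟨(d + (r - k), d + (k - r)), ?_, ?_⟩
    · have := mt (hh (d + (r - k)) (d + (k - r))) hc
      simp only [coe_product, Set.mem_prod, coe_range, Set.mem_Iio]
      omega
    · simp only [Prod.mk.injEq]
      omega
  · rintro ⟨i, j⟩ hp
    simp only [mem_product, mem_range] at *
    congr 1 <;> omega

lemma IsStrict.partSize_diagSet (hπ : π.IsStrict) (hb : π.IsBoxed r c) (k : ℕ) :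
    partSize (π.diagSet r k) = ∑ d ∈ range (r + c), π.diag r k d :=
  partSize_partSet (hπ.strictSeq_diag r k) fun _ hd ↦ hb.diag_eq_zero hd

lemma IsStrict.weight_eq (hπ : π.IsStrict) (hb : π.IsBoxed r c) :
    π.weight = ∑ k ∈ range (r + c + 1), partSize (π.diagSet r k) := by
  rw [weight, finsum_eq_sum_of_support_subset (s := range r ×ˢ range c), sum_box_eq_sum_diag hb]
  · exact sum_congr rfl fun k _ ↦ (hπ.partSize_diagSet hb k).symm
  · rintro ⟨i, j⟩ hp
    have := mt (hb i j) hp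
    simp only [coe_product, Set.mem_prod, coe_range, Set.mem_Iio]
    omega

lemma IsStrict.trace_eq (hπ : π.IsStrict) (hb : π.IsBoxed r c) :
    π.trace = partSize (π.diagSet r r) := by
  rw [trace, finsum_eq_sum_of_support_subset (s := range (r + c)), hπ.partSize_diagSet hb]
  · simp [diag]
  · intro i hi
    have := mt (hb i i) hi
    simp only [coe_range, Set.mem_Iio]
    omega

lemma IsStrict.isStart_iff (hπ : π.IsStrict) {k d : ℕ} :
    IsStart π.part (d + (r - (k + 1)), d + (k + 1 - r)) ↔
      π.diag r (k + 1) d ≠ 0 ∧ ∀ e, π.diag r k e ≠ π.diag r (k + 1) d := by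
  refine and_congr_right fun hd ↦ ?_
  have ha := hπ.strictSeq_diag r k
  change π.diag r (k + 1) d ≠ 0 at hd
  constructor
  · rintro h e he
    have hs (q : ℕ × ℕ) (hq : ((q.1 = d + (r - (k + 1)) ∧ q.2 + 1 = d + (k + 1 - r)) ∨
        (q.2 = d + (k + 1 - r) ∧ d + (r - (k + 1)) + 1 = q.1))) :
        ¬ π.part q.1 q.2 = π.diag r (k + 1) d := fun h' ↦ h q ⟨hq, h', h'.trans_ne hd⟩
    rcases lt_or_ge k r with hk | hk
    · have h1 := diag_up (π := π) hk
      have h2 : e = d ∨ e + 1 = d := by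
        by_contra! hc
        rcases lt_or_gt_of_ne hc.1 with hlt | hgt
        · have h3 := ha.lt (d := e) (e := d - 1) (by omega) (by omega)
          have h4 := (h1 (d - 1)).2
          rw [show d - 1 + 1 = d by omega] at h4
          omega
        · have h3 := ha.antitone hgt.le
          have h4 := ha.lt hgt (by omega)
          have h5 := (h1 d).1
          omega
      rw [diag] at he
      exact hs (e + (r - k), e + (k - r)) (by simp only; omega) he
    · have h1 := diag_down (π := π) hk
      have h2 : e = d ∨ e = d + 1 := by
        by_contra! hc
        rcases lt_or_gt_of_ne hc.1 with hlt | hgt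
        · have h3 := ha.lt hlt (by omega)
          have h4 := (h1 d).1
          omega
        · have h3 := ha.antitone (show d + 1 ≤ e by omega)
          have h4 := ha.lt (show d + 1 < e by omega) (by omega)
          have h5 := (h1 d).2
          omega
      rw [diag] at he
      exact hs (e + (r - k), e + (k - r)) (by simp only; omega) he
  · rintro h ⟨i, j⟩ ⟨hq, h', -⟩
    simp only at hq h'
    have hdiag : ∃ e, i = e + (r - k) ∧ j = e + (k - r) := by
      rcases lt_or_ge k r with hk | hk
      · exact ⟨j, by omega, by omega⟩
      · exact ⟨i, by omega, by omega⟩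
    obtain ⟨e, rfl, rfl⟩ := hdiag
    exact h e h'

lemma IsStrict.numComponents_eq_sum (hπ : π.IsStrict) (hb : π.IsBoxed r c) :
    numComponents π.part =
      ∑ k ∈ range (r + c), #(π.diagSet r (k + 1) \ π.diagSet r k) := by
  classical
  rw [hπ.numComponents_eq fun i j hi ↦ hb i j (.inl hi)]
  have hset : {p | IsStart π.part p} =
      (({p ∈ range r ×ˢ range c | IsStart π.part p} : Finset (ℕ × ℕ)) : Set (ℕ × ℕ)) := by
    ext ⟨i, j⟩
    simp only [coe_filter, mem_product, mem_range]
    refine ⟨fun h ↦ ⟨?_, h⟩, fun h ↦ h.2⟩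
    have := mt (hb i j) h.1
    omega
  rw [hset, Set.ncard_coe_finset, card_filter,
    sum_box_eq_sum_diag (h := fun i j ↦ if IsStart π.part (i, j) then 1 else 0)
      fun i j hij ↦ if_neg fun hs ↦ hs.1 (hb i j hij), sum_range_succ', add_eq_left.2]
  · refine sum_congr rfl fun k _ ↦ ?_
    have ha := hπ.strictSeq_diag r (k + 1)
    simp_rw [hπ.isStart_iff]
    rw [← card_filter, ← card_image_of_injOn (ha.injOn (by simp +contextual))]
    congr 1
    ext m
    simp only [mem_image, mem_filter, mem_range, Finset.mem_sdiff, diagSet, ha.mem_partSet,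
      (hπ.strictSeq_diag r k).mem_partSet, not_exists]
    constructor
    · rintro ⟨d, ⟨-, h1, h2⟩, rfl⟩
      exact ⟨⟨d, by omega⟩, fun e ↦ by have := h2 e; omega⟩
    · rintro ⟨⟨d, hd⟩, h⟩
      refine ⟨d, ⟨?_, by omega, fun e ↦ by rw [hd]; exact h e⟩, by omega⟩
      by_contra! hc
      have := hb.diag_eq_zero (k := k + 1) hc
      omega
  · exact sum_eq_zero fun d _ ↦ if_neg fun hs ↦ hs.1 (hb _ _ (.inl (by simp)))

/-- The weight of a boxed strict plane partition is a product over consecutive diagonals. -/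
lemma IsStrict.weight_eq_prod (hπ : π.IsStrict) (hb : π.IsBoxed r c) (x s : ℝ) :
    2 ^ numComponents π.part * x ^ π.trace * s ^ π.weight =
      ∏ k ∈ range (r + c), stepWeight x s r k (π.diagSet r k) (π.diagSet r (k + 1)) := by
  rw [prod_stepWeight x s hb.diagSet_zero hb.diagSet_last (fun k hk ↦ hπ.interlace_up hk)
    (fun k hk _ ↦ hπ.interlace_down hk), hπ.numComponents_eq_sum hb, hπ.trace_eq hb,
    hπ.weight_eq hb]

/-- The plane partition of which the diagonal of content `k - r` is `P k`. -/
noncomputable def ofDiagSets (r c : ℕ) (P : ℕ → Finset ℕ)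
    (hup : ∀ k < r, Interlace (P k) (P (k + 1)))
    (hdown : ∀ k, r ≤ k → k < r + c → Interlace (P (k + 1)) (P k)) : PlanePartition where
  part i j := if i < r ∧ j < c then partSeq (P (j + r - i)) (min i j) else 0
  row_decr i j := by
    split_ifs with h1 h2
    · rcases lt_or_ge j i with h | h
      · have := ((encodes_partSeq _).interlace_iff (encodes_partSeq _)).1
          (hup (j + r - i) (by omega)) j
        rw [show j + 1 + r - i = j + r - i + 1 by omega, show min i (j + 1) = j + 1 by omega,
          show min i j = j by omega]
        exact this.2
      · have := ((encodes_partSeq _).interlace_iff (encodes_partSeq _)).1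
          (hdown (j + r - i) (by omega) (by omega)) i
        rw [show j + 1 + r - i = j + r - i + 1 by omega, show min i (j + 1) = i by omega,
          show min i j = i by omega]
        exact this.1
    · omega
    · exact Nat.zero_le _
    · exact le_rfl
  col_decr i j := by
    split_ifs with h1 h2
    · rcases lt_or_ge i j with h | h
      · have := ((encodes_partSeq _).interlace_iff (encodes_partSeq _)).1
          (hdown (j + r - (i + 1)) (by omega) (by omega)) i
        rw [show j + r - i = j + r - (i + 1) + 1 by omega, show min (i + 1) j = i + 1 by omega,
          show min i j = i by omega]
        exact this.2
      · have := ((encodes_partSeq _).interlace_iff (encodes_partSeq _)).1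
          (hup (j + r - (i + 1)) (by omega)) j
        rw [show j + r - i = j + r - (i + 1) + 1 by omega, show min (i + 1) j = j by omega,
          show min i j = j by omega]
        exact this.1
    · omega
    · exact Nat.zero_le _
    · exact le_rfl
  finite_supp := by
    refine (range r ×ˢ range c).finite_toSet.subset fun p hp ↦ ?_
    have := (ite_ne_right_iff.1 hp).1
    simpa using this

section ofDiagSets

variable {P : ℕ → Finset ℕ} (hup : ∀ k < r, Interlace (P k) (P (k + 1)))
    (hdown : ∀ k, r ≤ k → k < r + c → Interlace (P (k + 1)) (P k))

lemma isBoxed_ofDiagSets : (ofDiagSets r c P hup hdown).IsBoxed r c := fun _ _ h ↦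
  if_neg (by omega)

lemma isStrict_ofDiagSets : (ofDiagSets r c P hup hdown).IsStrict := by
  intro i j h
  have h1 := (ite_ne_right_iff.1 h).1
  by_cases h2 : i + 1 < r ∧ j + 1 < c
  · have hs := (encodes_partSeq (P (j + r - i))).strictSeq (min i j)
    simp only [ofDiagSets, if_pos h1, if_pos h2] at h ⊢
    rw [show j + 1 + r - (i + 1) = j + r - i by omega,
      show min (i + 1) (j + 1) = min i j + 1 by omega]
    omega
  · refine lt_of_eq_of_lt (if_neg h2) (Nat.pos_of_ne_zero h)

lemma diagSet_ofDiagSets (h0 : P 0 = ∅) (h1 : P (r + c) = ∅) {k : ℕ} (hk : k ≤ r + c) :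
    (ofDiagSets r c P hup hdown).diagSet r k = P k := by
  have hl (k : ℕ) (hk : k ≤ r + c) : tailCard (P k) 0 ≤ min k r := by
    induction k with
    | zero => simp [h0, tailCard_empty]
    | succ k ih =>
      have ih := ih (by omega)
      rcases lt_or_ge k r with h | h
      · have := (hup k h 0).2
        omega
      · have := (hdown k h hk 0).1
        omega
  have hr (m : ℕ) (hm : m ≤ r + c) : tailCard (P (r + c - m)) 0 ≤ min m c := by
    induction m with
    | zero => simp [h1, tailCard_empty]
    | succ m ih =>
      have ih := ih (by omega)
      rw [show r + c - m = r + c - (m + 1) + 1 by omega] at ih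
      rcases lt_or_ge (r + c - (m + 1)) r with h | h
      · have := (hup _ h 0).1
        omega
      · have := (hdown _ h (by omega) 0).2
        omega
  have hd : (ofDiagSets r c P hup hdown).diag r k = partSeq (P k) := by
    funext d
    simp only [diag, ofDiagSets]
    split_ifs with h
    · congr 2 <;> omega
    · have h2 := hl k hk
      have h3 := hr (r + c - k) (by omega)
      rw [show r + c - (r + c - k) = k by omega] at h3
      have h4 := encodes_partSeq (P k) d 0
      omega
  have h := (isStrict_ofDiagSets hup hdown).encodes_diag r k
  rw [hd] at h
  exact h.finset_eq (encodes_partSeq _)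

end ofDiagSets

lemma ext_of_diagSet {π π' : PlanePartition} (hπ : π.IsStrict) (hb : π.IsBoxed r c)
    (hπ' : π'.IsStrict) (hb' : π'.IsBoxed r c)
    (h : ∀ k < r + c, π.diagSet r (k + 1) = π'.diagSet r (k + 1)) : π = π' := by
  have key : π.part = π'.part := by
    funext i j
    by_cases hij : i < r ∧ j < c
    · have h1 := hπ.encodes_diag r (j + r - i - 1 + 1)
      have h2 := hπ'.encodes_diag r (j + r - i - 1 + 1)
      rw [h _ (by omega)] at h1
      have h3 : π.diag r (j + r - i - 1 + 1) (min i j) =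
          π'.diag r (j + r - i - 1 + 1) (min i j) :=
        eq_of_forall_lt_iff fun n ↦ (h1 _ n).trans (h2 _ n).symm
      simp only [diag] at h3
      rwa [show min i j + (r - (j + r - i - 1 + 1)) = i by omega,
        show min i j + (j + r - i - 1 + 1 - r) = j by omega] at h3
    · rw [hb i j (by omega), hb' i j (by omega)]
  cases π
  cases π'
  simpa using key

end PlanePartition

lemma interlace_of_stepWeight_ne_zero {x s : ℝ} {r k : ℕ} {S T : Finset ℕ}
    (h : stepWeight x s r k S T ≠ 0) :
    (k < r → Interlace S T) ∧ (r ≤ k → Interlace T S) := by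
  rw [stepWeight, upWeight, downWeight] at h
  constructor <;> intro hk <;> by_contra hc <;> simp [hk, hc, not_lt.2] at h

/-- The generating function of boxed strict plane partitions as a sum over paths of finsets. -/
lemma tsum_planePartition_eq_pathSum {x s : ℝ} (hx : 0 ≤ x) (hs : 0 ≤ s) (r c : ℕ) :
    ∑' π : {π : PlanePartition // π.IsStrict ∧ π.IsBoxed r c}, ENNReal.ofReal
      (2 ^ numComponents π.1.part * x ^ π.1.trace * s ^ π.1.weight) =
    pathSum ((List.range (r + c)).map fun k S T ↦ ENNReal.ofReal (stepWeight x s r k S T)) ∅ := by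
  rw [pathSum_range]
  set e : {π : PlanePartition // π.IsStrict ∧ π.IsBoxed r c} → Fin (r + c) → Finset ℕ :=
    fun π k ↦ π.1.diagSet r (k + 1) with he
  have hcons (π : {π : PlanePartition // π.IsStrict ∧ π.IsBoxed r c}) :
      (Fin.cons ∅ (e π) : Fin (r + c + 1) → Finset ℕ) =
        fun k : Fin (r + c + 1) ↦ π.1.diagSet r k := by
    funext k
    refine Fin.cases ?_ (fun k ↦ ?_) k
    · exact (π.2.2.diagSet_zero).symm
    · simp [he]
  have hinj : Function.Injective e := fun π π' h ↦ Subtype.ext <|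
    PlanePartition.ext_of_diagSet π.2.1 π.2.2 π'.2.1 π'.2.2 fun k hk ↦ congrFun h ⟨k, hk⟩
  rw [← hinj.tsum_eq]
  · refine tsum_congr fun π ↦ ?_
    rw [hcons, if_pos (by simpa using π.2.2.diagSet_last), π.2.1.weight_eq_prod π.2.2,
      ENNReal.ofReal_prod_of_nonneg fun _ _ ↦ stepWeight_nonneg hx hs _ _ _ _,
      ← Fin.prod_univ_eq_prod_range
        (fun k ↦ ENNReal.ofReal (stepWeight x s r k (π.1.diagSet r k) (π.1.diagSet r (k + 1))))]
    rfl
  · intro f hf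
    obtain ⟨hlast, hne⟩ := ite_ne_right_iff.1 hf
    set F : Fin (r + c + 1) → Finset ℕ := Fin.cons ∅ f with hF
    set P : ℕ → Finset ℕ := fun k ↦ if h : k < r + c + 1 then F ⟨k, h⟩ else ∅ with hP
    have hPsucc (k : ℕ) (hk : k < r + c) : P (k + 1) = f ⟨k, hk⟩ := by
      rw [hP]
      simp only [Nat.add_lt_add_iff_right, hk, dif_pos]
      exact Fin.cons_succ (α := fun _ ↦ Finset ℕ) ∅ f ⟨k, hk⟩
    have hint (k : ℕ) (hk : k < r + c) : stepWeight x s r k (P k) (P (k + 1)) ≠ 0 := by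
      have h := prod_ne_zero_iff.1 hne ⟨k, hk⟩ (mem_univ _)
      rw [hPsucc k hk, show P k = F (Fin.castSucc ⟨k, hk⟩) from dif_pos (Nat.lt_succ_of_lt hk)]
      intro h'
      exact h ((congrArg ENNReal.ofReal h').trans ENNReal.ofReal_zero)
    have hup (k : ℕ) (hk : k < r) : Interlace (P k) (P (k + 1)) :=
      (interlace_of_stepWeight_ne_zero (hint k (by omega))).1 hk
    have hdown (k : ℕ) (hk : r ≤ k) (hk' : k < r + c) : Interlace (P (k + 1)) (P k) :=
      (interlace_of_stepWeight_ne_zero (hint k hk')).2 hk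
    have h0 : P 0 = ∅ := by simp [hP, hF]
    have h1 : P (r + c) = ∅ := (dif_pos (Nat.lt_succ_self _)).trans hlast
    refine ⟨⟨PlanePartition.ofDiagSets r c P hup hdown,
      PlanePartition.isStrict_ofDiagSets hup hdown,
      PlanePartition.isBoxed_ofDiagSets hup hdown⟩, ?_⟩
    funext k
    exact (PlanePartition.diagSet_ofDiagSets hup hdown h0 h1 k.2).trans (hPsucc k k.2)

end

/-- **Generalized shifted MacMahon's formula (boxed version).**
For positive integers `r`, `c`,
`∑_{π ∈ SP(r,c)} 2^{k(π)} x^{tr(π)} s^{|π|}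
  = ∏_{i=1}^{r} ∏_{j=1}^{c} (1 + x s^{i+j-1}) / (1 - x s^{i+j-1})`,
for real `0 ≤ x, s < 1`.  Here `SP(r,c)` is the set of strict plane
partitions with at most `r` rows and `c` columns, `tr` is the trace and
`k(π)` the number of connected components. -/
theorem generalized_shifted_macmahon_boxed
    (x s : ℝ) (hx0 : 0 ≤ x) (hx1 : x < 1) (hs0 : 0 ≤ s) (hs1 : s < 1)
    (r c : ℕ) (hr : 0 < r) (hc : 0 < c) :
    ∑' π : {π : PlanePartition //
        π.IsStrict ∧ ∀ i j, r ≤ i ∨ c ≤ j → π.part i j = 0},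
        (2 : ℝ) ^ numComponents π.1.part * x ^ π.1.trace * s ^ π.1.weight =
      ∏ i ∈ Finset.range r, ∏ j ∈ Finset.range c,
        (1 + x * s ^ (i + j + 1)) / (1 - x * s ^ (i + j + 1)) := by
  have hlt (n : ℕ) : x * s ^ n < 1 :=
    (mul_le_of_le_one_right hx0 (pow_le_one₀ hs0 hs1.le)).trans_lt hx1
  have key := (tsum_planePartition_eq_pathSum hx0 hs0 r c).trans
    (pathSum_stepWeight hx0 hx1 hs0 hs1 r c)
  have h := congrArg ENNReal.toReal key
  rw [ENNReal.tsum_toReal_eq fun _ ↦ ENNReal.ofReal_ne_top, ENNReal.toReal_ofReal] at h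
  · rw [← h]
    exact tsum_congr fun π ↦ (ENNReal.toReal_ofReal (by positivity)).symm
  · exact Finset.prod_nonneg fun i _ ↦ Finset.prod_nonneg fun j _ ↦
      div_nonneg (by positivity) (sub_nonneg.2 (hlt _).le)
end
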